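/- The nine polynomials a₁², a₂², a₃², a₁a₂, a₁a₃, a₂a₃, b₁b₂, b₂b₃, b₂b₄ are linearly independent over ℂ in ℂ[s,t,x,y]. (These nine products represent, modulo the relations f₁ = f₂ = f₃ = 0 and the vanishing quadric Q, a basis of the space of quadratic differentials H⁰(Z, ω_Z⊗ω_Z) of the genus-4 quotient curve Z.) -/

import Mathlib

noncomputable section
namespace Koike

open MvPolynomial

abbrev R4 : Type := MvPolynomial (Fin 4) ℂ

def s : R4 := X 0
def t : R4 := X 1
def x : R4 := X 2
def y : R4 := X 3

/-- the imaginary unit as a constant polynomial -/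
def i : R4 := C Complex.I

def a1 : R4 := s + t + x + y
def a2 : R4 := s*t + t*x + x*y + y*s
def a3 : R4 := t*x*y + s*x*y + s*t*y + s*t*x
def a4 : R4 := s*x + t*y
def a5 : R4 := s*t*x*y
def a6 : R4 := 1

def b1 : R4 := s - t + x - y
def b2 : R4 := s*t - t*x + x*y - y*s
def b3 : R4 := t*x*y - s*x*y + s*t*y - s*t*x
def b4 : R4 := s*x - t*y

def c1 : R4 := s - i*t - x + i*y
def c2 : R4 := s*t - i*(t*x) - x*y + i*(y*s)
def c3 : R4 := t*x*y - i*(s*x*y) - s*t*y + i*(s*t*x)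

def d1 : R4 := s + i*t - x - i*y
def d2 : R4 := s*t + i*(t*x) - x*y - i*(y*s)
def d3 : R4 := t*x*y + i*(s*x*y) - s*t*y - i*(s*t*x)

/-- the pullback `σ* : ℂ[s,t,x,y] → ℂ[s,t,x,y]`, determined by
`s ↦ y, t ↦ s, x ↦ t, y ↦ x`. -/
def sigmaStar : R4 →ₐ[ℂ] R4 := aeval ![y, s, t, x]

/-- the pullback `τ* : ℂ[s,t,x,y] → ℂ[s,t,x,y]`, determined by
`s ↦ x, t ↦ t, x ↦ s, y ↦ y`. -/
def tauStar : R4 →ₐ[ℂ] R4 := aeval ![x, t, s, y]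
/-- The nine products `a₁², a₂², a₃², a₁a₂, a₁a₃, a₂a₃, b₁b₂, b₂b₃, b₂b₄`
are linearly independent over ℂ. -/
theorem stmt_16 :
    LinearIndependent ℂ
      ![a1^2, a2^2, a3^2, a1*a2, a1*a3, a2*a3, b1*b2, b2*b3, b2*b4] := by
  rw [Fintype.linearIndependent_iff]
  intro g hg
  have key (p : Fin 4 → ℂ) := congrArg (eval p) hg
  simp only [Fin.sum_univ_succ, smul_eq_C_mul, a1, a2, a3, b1, b2, b3, b4, s, t, x, y] at key
  simp at key
  have h0 := key ![1, 0, 0, 0]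
  have h1 := key ![1, 1, 0, 0]
  have h2 := key ![1, -1, 0, 0]
  have h3 := key ![2, 1, 0, 0]
  have h4 := key ![1, 1, 1, 0]
  have h5 := key ![1, 1, 1, -1]
  have h6 := key ![1, 2, 1, 0]
  have h7 := key ![2, 1, 1, 0]
  have h8 := key ![2, -1, 1, 0]
  simp at h0 h1 h2 h3 h4 h5 h6 h7 h8
  intro j
  fin_cases j <;> simp <;> grind

end Koike
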